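/- With α > 0, s_α² = α/(2+α), and ã_α as in the gluing construction, for every β ∈ (0,1) and all sufficiently small s_α one has ∫_{B_1} |x|² |log|x||^β |∇ã_α|² dx ≤ C |log s_α|^β for a constant C independent of α, while for the glued function h_α one has ∫_{B_1} |x|² |∇h_α|² dx ≥ C⁻¹ |log s_α|; hence the ratio ∫|x|²|∇h_α|² / ∫|x|²|log|x||^β|∇ã_α|² tends to ∞ as α → 0⁺. -/

import Mathlib

open MeasureTheory Real Set Filter

noncomputable section

abbrev E2 := EuclideanSpace ℝ (Fin 2)

/-- i-th weak (pointwise) partial derivative -/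
noncomputable def pd (f : E2 → ℝ) (i : Fin 2) (x : E2) : ℝ :=
  fderiv ℝ f x (EuclideanSpace.single i 1)

/-- squared norm of the gradient -/
noncomputable def gradSq (f : E2 → ℝ) (x : E2) : ℝ :=
  (pd f 0 x) ^ 2 + (pd f 1 x) ^ 2

/-- the Jacobian ∇a · ∇⊥b with ∇⊥b = (−∂₂ b, ∂₁ b) -/
noncomputable def jac (a b : E2 → ℝ) (x : E2) : ℝ :=
  pd a 0 x * (-(pd b 1 x)) + pd a 1 x * (pd b 0 x)

/-- the open unit disk -/
def B1 : Set E2 := Metric.ball 0 1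

/-- f ∈ W^{1,2}(B₁): f and its gradient are square integrable on B₁ -/
def MemW12 (f : E2 → ℝ) : Prop :=
  MeasureTheory.IntegrableOn (fun x => (f x) ^ 2) B1 ∧
  MeasureTheory.IntegrableOn (gradSq f) B1

/-- φ is the weak solution of Δφ = ∇a·∇⊥b on B₁ with zero Dirichlet boundary data -/
def IsWeakSol (φ a b : E2 → ℝ) : Prop :=
  (∀ x ∈ Metric.sphere (0 : E2) 1, φ x = 0) ∧
  ∀ ψ : E2 → ℝ, ContDiff ℝ (⊤ : ℕ∞) ψ → HasCompactSupport ψ → tsupport ψ ⊆ B1 →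
    ∫ x in B1, (pd φ 0 x * pd ψ 0 x + pd φ 1 x * pd ψ 1 x) =
      - ∫ x in B1, jac a b x * ψ x

lemma gradSq_eq_of_hasFDerivAt {f : E2 → ℝ} {f' : E2 →L[ℝ] ℝ} {x : E2}
    (hf : HasFDerivAt f f' x) :
    gradSq f x = f' (EuclideanSpace.single 0 1) ^ 2 + f' (EuclideanSpace.single 1 1) ^ 2 := by
  simp only [gradSq, pd, hf.fderiv]

lemma measurable_gradSq (f : E2 → ℝ) : Measurable (gradSq f) :=
  ((measurable_fderiv_apply_const ℝ f _).pow_const 2).add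
    ((measurable_fderiv_apply_const ℝ f _).pow_const 2)

lemma gradSq_nonneg (f : E2 → ℝ) (x : E2) : 0 ≤ gradSq f x := by
  unfold gradSq; positivity

lemma gradSq_congr {f g : E2 → ℝ} {x : E2} (h : f =ᶠ[nhds x] g) : gradSq f x = gradSq g x := by
  simp only [gradSq, pd, h.fderiv_eq]

lemma norm_sq_eq_coords (x : E2) : ‖x‖ ^ 2 = x 0 ^ 2 + x 1 ^ 2 := by
  rw [EuclideanSpace.real_norm_sq_eq, Fin.sum_univ_two]

lemma innerSL_apply_single (x : E2) (i : Fin 2) :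
    innerSL ℝ x (EuclideanSpace.single i 1) = x i := by
  simp [innerSL_apply_apply, EuclideanSpace.inner_single_right]

lemma hasFDerivAt_norm {x : E2} (hx : x ≠ 0) :
    HasFDerivAt (fun y : E2 => ‖y‖) (‖x‖⁻¹ • innerSL ℝ x) x := by
  have hn : ‖x‖ ≠ 0 := norm_ne_zero_iff.2 hx
  have h := (hasStrictFDerivAt_norm_sq x).hasFDerivAt.sqrt (pow_ne_zero 2 hn)
  simp only [Real.sqrt_sq (norm_nonneg _)] at h
  have heq : (1 / (2 * ‖x‖)) • 2 • innerSL ℝ x = ‖x‖⁻¹ • innerSL ℝ x := by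
    refine ContinuousLinearMap.ext fun y => ?_
    simp only [smul_apply, nsmul_eq_mul, smul_eq_mul]
    field_simp
    norm_num
  rwa [heq] at h

lemma hasFDerivAt_coord (x : E2) (i : Fin 2) :
    HasFDerivAt (fun y : E2 => y i) (EuclideanSpace.proj i : E2 →L[ℝ] ℝ) x :=
  (EuclideanSpace.proj i : E2 →L[ℝ] ℝ).hasFDerivAt

lemma gradSq_const_mul_norm_rpow (c a : ℝ) {x : E2} (hx : x ≠ 0) :
    gradSq (fun y => c * ‖y‖ ^ a) x = (c * a * ‖x‖ ^ (a - 1)) ^ 2 := by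
  have hn : ‖x‖ ≠ 0 := norm_ne_zero_iff.2 hx
  rw [gradSq_eq_of_hasFDerivAt (((hasFDerivAt_norm hx).rpow_const (p := a) (Or.inl hn)).const_mul c)]
  simp only [smul_apply, innerSL_apply_single, smul_eq_mul]
  have := norm_sq_eq_coords x
  field_simp
  linear_combination (-(c ^ 2 * a ^ 2)) * this

lemma gradSq_coord_mul_norm_rpow_le (c : ℝ) {a : ℝ} (ha : 0 ≤ a) {x : E2} (hx : x ≠ 0)
    (hx1 : ‖x‖ ≤ 1) :
    gradSq (fun y => c * (y 0 * ‖y‖ ^ a)) x ≤ 2 * (c * (1 + a)) ^ 2 := by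
  have hn : 0 < ‖x‖ := norm_pos_iff.2 hx
  have hp : ‖x‖ ^ (a - 1) = ‖x‖ ^ a / ‖x‖ := by rw [Real.rpow_sub hn, Real.rpow_one]
  have hr0 : 0 ≤ ‖x‖ ^ a := Real.rpow_nonneg hn.le _
  have hr1 : ‖x‖ ^ a ≤ 1 := Real.rpow_le_one hn.le hx1 ha
  have hsq := norm_sq_eq_coords x
  have h : HasFDerivAt (fun y : E2 => c * (y 0 * ‖y‖ ^ a)) _ x :=
    ((hasFDerivAt_coord x 0).mul
      ((hasFDerivAt_norm hx).rpow_const (p := a) (Or.inl hn.ne'))).const_mul c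
  rw [gradSq_eq_of_hasFDerivAt h]
  simp only [smul_apply, add_apply, innerSL_apply_single,
    smul_eq_mul, hp]
  simp only [PiLp.proj_apply, PiLp.single_apply]
  norm_num
  have key : (c * (x 0 * (a * (‖x‖ ^ a / ‖x‖) * (‖x‖⁻¹ * x 0)) + ‖x‖ ^ a)) ^ 2 +
      (c * (x 0 * (a * (‖x‖ ^ a / ‖x‖) * (‖x‖⁻¹ * x 1)))) ^ 2 =
      (c * ‖x‖ ^ a) ^ 2 * (1 + (2 * a + a ^ 2) * (x 0 ^ 2 / ‖x‖ ^ 2)) := by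
    field_simp
    linear_combination (-(c ^ 2 * x 0 ^ 2 * a ^ 2)) * hsq
  rw [key]
  have hq0 : 0 ≤ x 0 ^ 2 / ‖x‖ ^ 2 := by positivity
  have hq : x 0 ^ 2 / ‖x‖ ^ 2 ≤ 1 := by
    rw [div_le_one (by positivity)]; nlinarith [sq_nonneg (x 1)]
  have h1 : (c * ‖x‖ ^ a) ^ 2 ≤ c ^ 2 := by
    rw [mul_pow]
    exact mul_le_of_le_one_right (sq_nonneg c) (pow_le_one₀ hr0 hr1)
  have h2 : 1 + (2 * a + a ^ 2) * (x 0 ^ 2 / ‖x‖ ^ 2) ≤ (1 + a) ^ 2 := by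
    nlinarith [mul_nonneg (by positivity : 0 ≤ 2 * a + a ^ 2) (sub_nonneg.2 hq)]
  calc (c * ‖x‖ ^ a) ^ 2 * (1 + (2 * a + a ^ 2) * (x 0 ^ 2 / ‖x‖ ^ 2))
      ≤ c ^ 2 * (1 + a) ^ 2 := mul_le_mul h1 h2 (by positivity) (sq_nonneg c)
    _ ≤ 2 * (c * (1 + a)) ^ 2 := by nlinarith [sq_nonneg (c * (1 + a))]

lemma gradSq_coord_div_norm_sq_sub {x : E2} (hx : x ≠ 0) :
    gradSq (fun y => y 0 / ‖y‖ ^ 2 - y 0) x =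
      ((‖x‖ ^ 2)⁻¹ - 1) ^ 2 + 4 * x 0 ^ 2 / ‖x‖ ^ 4 := by
  have hn : ‖x‖ ≠ 0 := norm_ne_zero_iff.2 hx
  have hsq := norm_sq_eq_coords x
  have hinv := (hasDerivAt_inv (pow_ne_zero 2 hn)).comp_hasFDerivAt x
    (hasStrictFDerivAt_norm_sq x).hasFDerivAt
  have h := ((hasFDerivAt_coord x 0).mul hinv).sub (hasFDerivAt_coord x 0)
  have h' : HasFDerivAt (fun y : E2 => y 0 / ‖y‖ ^ 2 - y 0) _ x := h
  rw [gradSq_eq_of_hasFDerivAt h']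
  simp only [smul_apply, add_apply, innerSL_apply_single,
    sub_apply, smul_eq_mul, nsmul_eq_mul, Function.comp,
    PiLp.proj_apply, PiLp.single_apply]
  norm_num
  field_simp
  linear_combination (-4 * x 0 ^ 2) * hsq

lemma gradSq_ite_of_lt {f g : E2 → ℝ} {s : ℝ} {x : E2} (hx : ‖x‖ < s) :
    gradSq (fun y => if ‖y‖ ≤ s then f y else g y) x = gradSq f x := by
  refine gradSq_congr ?_
  filter_upwards [(isOpen_lt continuous_norm continuous_const).mem_nhds hx] with y hy
  exact if_pos (le_of_lt hy)

lemma gradSq_ite_of_gt {f g : E2 → ℝ} {s : ℝ} {x : E2} (hx : s < ‖x‖) :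
    gradSq (fun y => if ‖y‖ ≤ s then f y else g y) x = gradSq g x := by
  refine gradSq_congr ?_
  filter_upwards [(isOpen_lt continuous_const continuous_norm).mem_nhds hx] with y hy
  exact if_neg (not_le.2 hy)

lemma gradSq_const (c : ℝ) (x : E2) : gradSq (fun _ => c) x = 0 := by
  simp [gradSq, pd]

lemma ae_ne_zero_and_norm_ne (s : ℝ) : ∀ᵐ x : E2, x ≠ 0 ∧ ‖x‖ ≠ s := by
  have h1 : ∀ᵐ x : E2, x ≠ 0 := by simp [ae_iff]
  have h2 : ∀ᵐ x : E2, ‖x‖ ≠ s := by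
    have := Measure.addHaar_sphere (volume : Measure E2) 0 s
    rw [ae_iff]
    convert this using 2
    ext x; simp
  exact h1.and h2

lemma measurableSet_B1 : MeasurableSet B1 := measurableSet_ball

lemma mem_B1 {x : E2} : x ∈ B1 ↔ ‖x‖ < 1 := by simp [B1]

lemma integrableOn_inv_norm : IntegrableOn (fun x : E2 => ‖x‖⁻¹) B1 := by
  refine (integrableOn_fun_norm_addHaar (volume : Measure E2) (f := fun y => y⁻¹)).2 ?_
  have : IntegrableOn (fun _ : ℝ => (1 : ℝ)) (Ioo 0 1) := by simp
  refine this.congr_fun (fun y hy => ?_) measurableSet_Ioo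
  have : y ≠ 0 := hy.1.ne'
  simp [this]

lemma abs_log_rpow_le_inv {r β : ℝ} (hr : 0 < r) (hr1 : r < 1) (hβ : 0 < β) (hβ1 : β < 1) :
    |Real.log r| ^ β ≤ r⁻¹ := by
  have h1 : 1 ≤ r⁻¹ := (one_le_inv₀ hr).2 hr1.le
  have h2 : |Real.log r| ≤ r⁻¹ := by
    rw [abs_of_neg (Real.log_neg hr hr1)]
    linarith [Real.one_sub_inv_le_log_of_pos hr]
  calc |Real.log r| ^ β ≤ r⁻¹ ^ β := Real.rpow_le_rpow (abs_nonneg _) h2 hβ.le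
    _ ≤ r⁻¹ ^ (1 : ℝ) := Real.rpow_le_rpow_of_exponent_le h1 hβ1.le
    _ = r⁻¹ := Real.rpow_one _

/-- The truncated power `c |x|^α`, frozen outside the ball of radius `s`. -/
def truncPow (s c α : ℝ) (y : E2) : ℝ :=
  if ‖y‖ ≤ s then c * ‖y‖ ^ α else c * s ^ α

/-- The function glued from `K x₁ |x|^α` inside and `x₁ / |x|² - x₁` outside the ball of
radius `s`. -/
def gluedFun (s K α : ℝ) (y : E2) : ℝ :=
  if ‖y‖ ≤ s then K * (y 0 * ‖y‖ ^ α) else y 0 / ‖y‖ ^ 2 - y 0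

lemma gradSq_truncPow_of_gt {s c α : ℝ} {x : E2} (hx : s < ‖x‖) :
    gradSq (truncPow s c α) x = 0 :=
  (gradSq_ite_of_gt hx).trans (gradSq_const _ x)

lemma norm_sq_mul_gradSq_truncPow {s α : ℝ} (hs : 0 < s) (hα : α = s ^ 2 * (2 + α)) {x : E2}
    (hx : x ≠ 0) (hxs : ‖x‖ < s) :
    ‖x‖ ^ 2 * gradSq (truncPow s (s ^ (-α - 2) * (1 - s ^ 2) * (α + 2)) α) x =
      ((‖x‖ / s) ^ α * (1 - s ^ 2) * (2 + α) ^ 2) ^ 2 := by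
  have hn : 0 < ‖x‖ := norm_pos_iff.2 hx
  have h := (gradSq_ite_of_lt (g := fun _ => s ^ (-α - 2) * (1 - s ^ 2) * (α + 2) * s ^ α)
    hxs).trans (gradSq_const_mul_norm_rpow (s ^ (-α - 2) * (1 - s ^ 2) * (α + 2)) α hx)
  have h' : gradSq (truncPow s (s ^ (-α - 2) * (1 - s ^ 2) * (α + 2)) α) x = _ := h
  have hsa : s ^ α ≠ 0 := (Real.rpow_pos_of_pos hs _).ne'
  rw [h', Real.rpow_sub hs, Real.rpow_neg hs.le, Real.rpow_sub hn, Real.div_rpow hn.le hs.le,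
    Real.rpow_one, Real.rpow_two, ← mul_pow]
  congr 1
  field_simp
  linear_combination (1 - s ^ 2) * (α + 2) * hα

lemma weighted_gradSq_truncPow_le {s α β : ℝ} (hs : 0 < s) (hs1 : s < 1) (hα0 : 0 < α)
    (hα1 : α < 1) (hα : α = s ^ 2 * (2 + α)) (hβ : 0 < β) (hβ1 : β < 1) {x : E2}
    (hx : x ≠ 0) (hxs : ‖x‖ ≠ s) (hx1 : ‖x‖ < 1) :
    ‖x‖ ^ 2 * |Real.log ‖x‖| ^ β *
      gradSq (truncPow s (s ^ (-α - 2) * (1 - s ^ 2) * (α + 2)) α) x ≤ 81 * ‖x‖⁻¹ := by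
  have hn : 0 < ‖x‖ := norm_pos_iff.2 hx
  rcases lt_or_gt_of_ne hxs with h | h
  · rw [mul_right_comm, norm_sq_mul_gradSq_truncPow hs hα hx h]
    have hq1 : (‖x‖ / s) ^ α ≤ 1 :=
      Real.rpow_le_one (by positivity) ((div_le_one hs).2 h.le) hα0.le
    have hq0 : 0 ≤ (‖x‖ / s) ^ α := by positivity
    have hs2 : 0 ≤ 1 - s ^ 2 := by nlinarith
    have hs3 : 1 - s ^ 2 ≤ 1 := by nlinarith
    have h9 : (2 + α) ^ 2 ≤ 9 := by nlinarith
    have hb : (‖x‖ / s) ^ α * (1 - s ^ 2) * (2 + α) ^ 2 ≤ 1 * 1 * 9 := by gcongr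
    have hb2 : ((‖x‖ / s) ^ α * (1 - s ^ 2) * (2 + α) ^ 2) ^ 2 ≤ (1 * 1 * 9) ^ 2 := by gcongr
    calc _ ≤ (1 * 1 * 9) ^ 2 * ‖x‖⁻¹ :=
          mul_le_mul hb2 (abs_log_rpow_le_inv hn hx1 hβ hβ1) (by positivity) (by positivity)
      _ = 81 * ‖x‖⁻¹ := by norm_num
  · rw [gradSq_truncPow_of_gt h, mul_zero]
    positivity

lemma weighted_energy_truncPow {s α β : ℝ} (hs : 0 < s) (hs1 : s < 1) (hα0 : 0 < α)
    (hα1 : α < 1) (hα : α = s ^ 2 * (2 + α)) (hβ : 0 < β) (hβ1 : β < 1) :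
    (0 < ∫ x in B1, ‖x‖ ^ 2 * |Real.log ‖x‖| ^ β *
      gradSq (truncPow s (s ^ (-α - 2) * (1 - s ^ 2) * (α + 2)) α) x) ∧
    ∫ x in B1, ‖x‖ ^ 2 * |Real.log ‖x‖| ^ β *
      gradSq (truncPow s (s ^ (-α - 2) * (1 - s ^ 2) * (α + 2)) α) x ≤
        81 * ∫ x in B1, ‖x‖⁻¹ := by
  set f := truncPow s (s ^ (-α - 2) * (1 - s ^ 2) * (α + 2)) α with hf
  have hnonneg : ∀ x : E2, 0 ≤ ‖x‖ ^ 2 * |Real.log ‖x‖| ^ β * gradSq f x := fun x =>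
    mul_nonneg (by positivity) (gradSq_nonneg _ _)
  have hle : ∀ᵐ x : E2 ∂volume.restrict B1,
      ‖x‖ ^ 2 * |Real.log ‖x‖| ^ β * gradSq f x ≤ 81 * ‖x‖⁻¹ := by
    rw [ae_restrict_iff' measurableSet_B1]
    filter_upwards [ae_ne_zero_and_norm_ne s] with x hx hx1
    exact weighted_gradSq_truncPow_le hs hs1 hα0 hα1 hα hβ hβ1 hx.1 hx.2 (mem_B1.1 hx1)
  have hdom : IntegrableOn (fun x : E2 => 81 * ‖x‖⁻¹) B1 := integrableOn_inv_norm.const_mul 81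
  have hmeas : Measurable fun x : E2 => ‖x‖ ^ 2 * |Real.log ‖x‖| ^ β * gradSq f x := by
    have := measurable_gradSq f
    fun_prop
  have hint : IntegrableOn (fun x : E2 => ‖x‖ ^ 2 * |Real.log ‖x‖| ^ β * gradSq f x) B1 := by
    refine Integrable.mono' hdom hmeas.aestronglyMeasurable ?_
    filter_upwards [hle] with x hx
    rwa [Real.norm_of_nonneg (hnonneg x)]
  constructor
  · rw [setIntegral_pos_iff_support_of_nonneg_ae (Eventually.of_forall hnonneg) hint]
    have hpos : 0 < volume (Metric.ball (0 : E2) s \ {0}) := by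
      rw [measure_sdiff_null (measure_singleton _)]
      exact Metric.measure_ball_pos _ _ hs
    refine hpos.trans_le (measure_mono ?_)
    rintro x ⟨hxs, hx⟩
    replace hxs : ‖x‖ < s := by simpa using hxs
    replace hx : x ≠ 0 := hx
    have hn : 0 < ‖x‖ := norm_pos_iff.2 hx
    have hx1 : ‖x‖ < 1 := hxs.trans hs1
    refine ⟨?_, mem_B1.2 hx1⟩
    rw [Function.mem_support, mul_right_comm, norm_sq_mul_gradSq_truncPow hs hα hx hxs]
    have hlog : 0 < |Real.log ‖x‖| := abs_pos.2 (Real.log_neg hn hx1).ne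
    have hs2 : 0 < 1 - s ^ 2 := by nlinarith
    positivity
  · rw [← integral_const_mul]
    exact integral_mono_ae hint hdom hle

lemma norm_sq_mul_gradSq_gluedFun_of_gt {s K α : ℝ} {x : E2} (hx : x ≠ 0) (hxs : s < ‖x‖) :
    ‖x‖ ^ 2 * gradSq (gluedFun s K α) x =
      ‖x‖ ^ 2 * (((‖x‖ ^ 2)⁻¹ - 1) ^ 2 + 4 * x 0 ^ 2 / ‖x‖ ^ 4) := by
  congr 1
  exact (gradSq_ite_of_gt hxs).trans (gradSq_coord_div_norm_sq_sub hx)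

lemma integrableOn_norm_sq_mul_gradSq_gluedFun {s α : ℝ} (K : ℝ) (hs : 0 < s) (hα : 0 ≤ α) :
    IntegrableOn (fun x => ‖x‖ ^ 2 * gradSq (gluedFun s K α) x) B1 := by
  have hmeas : Measurable fun x => ‖x‖ ^ 2 * gradSq (gluedFun s K α) x := by
    have := measurable_gradSq (gluedFun s K α)
    fun_prop
  refine Measure.integrableOn_of_bounded (M := 2 * (K * (1 + α)) ^ 2 + (((s ^ 2)⁻¹) ^ 2 + 4 / s ^ 2))
    measure_ball_lt_top.ne hmeas.aestronglyMeasurable ?_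
  rw [ae_restrict_iff' measurableSet_B1]
  filter_upwards [ae_ne_zero_and_norm_ne s] with x ⟨hx, hxs⟩ hx1
  rw [mem_B1] at hx1
  have hn : 0 < ‖x‖ := norm_pos_iff.2 hx
  have hsq1 : ‖x‖ ^ 2 ≤ 1 := pow_le_one₀ hn.le hx1.le
  rw [Real.norm_of_nonneg (mul_nonneg (sq_nonneg _) (gradSq_nonneg _ _))]
  refine (mul_le_of_le_one_left (gradSq_nonneg _ _) hsq1).trans ?_
  rcases lt_or_gt_of_ne hxs with h | h
  · have h1 : gradSq (gluedFun s K α) x ≤ 2 * (K * (1 + α)) ^ 2 :=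
      (gradSq_ite_of_lt h).trans_le (gradSq_coord_mul_norm_rpow_le K hα hx hx1.le)
    exact h1.trans (le_add_of_nonneg_right (by positivity))
  · have h1 : gradSq (gluedFun s K α) x = _ :=
      (gradSq_ite_of_gt h).trans (gradSq_coord_div_norm_sq_sub hx)
    rw [h1]
    have hi1 : 1 ≤ (‖x‖ ^ 2)⁻¹ := (one_le_inv₀ (by positivity)).2 hsq1
    have hi2 : (‖x‖ ^ 2)⁻¹ ≤ (s ^ 2)⁻¹ := by gcongr
    have hb1 : ((‖x‖ ^ 2)⁻¹ - 1) ^ 2 ≤ ((s ^ 2)⁻¹) ^ 2 :=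
      pow_le_pow_left₀ (by linarith) (by linarith) 2
    have hb2 : 4 * x 0 ^ 2 / ‖x‖ ^ 4 ≤ 4 / s ^ 2 := by
      have h0 : x 0 ^ 2 ≤ ‖x‖ ^ 2 := by
        rw [norm_sq_eq_coords]; exact le_add_of_nonneg_right (sq_nonneg _)
      calc 4 * x 0 ^ 2 / ‖x‖ ^ 4 ≤ 4 * ‖x‖ ^ 2 / ‖x‖ ^ 4 := by gcongr
        _ = 4 / ‖x‖ ^ 2 := by field_simp
        _ ≤ 4 / s ^ 2 := by gcongr
    have := sq_nonneg (K * (1 + α))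
    linarith

lemma radial_lower_energy {s : ℝ} (hs : 0 < s) (hs1 : s < 1) :
    IntegrableOn (fun x : E2 => (Ioo s 1).indicator (fun r => (r ^ 2)⁻¹ - 2) ‖x‖) B1 ∧
    ∫ x : E2 in B1, (Ioo s 1).indicator (fun r => (r ^ 2)⁻¹ - 2) ‖x‖ =
      2 * volume.real (Metric.ball (0 : E2) 1) * (-Real.log s - (1 - s ^ 2)) := by
  set g : ℝ → ℝ := (Ioo s 1).indicator fun r => (r ^ 2)⁻¹ - 2
  have hprod : (fun y : ℝ => y ^ (Module.finrank ℝ E2 - 1) • g y) =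
      (Ioo s 1).indicator fun y => y⁻¹ - 2 * y := by
    funext y
    by_cases hy : y ∈ Ioo s 1
    · have : y ≠ 0 := (hs.trans hy.1).ne'
      simp only [g, indicator_of_mem hy, finrank_euclideanSpace_fin, smul_eq_mul]
      norm_num
      field_simp
    · simp [g, indicator_of_notMem hy]
  have hcont : ContinuousOn (fun y : ℝ => y⁻¹ - 2 * y) (Icc s 1) := by
    refine (continuousOn_id.inv₀ fun y hy => (hs.trans_le hy.1).ne').sub ?_
    fun_prop
  have hintIoo : IntegrableOn (fun y : ℝ => y⁻¹ - 2 * y) (Ioo s 1) :=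
    (hcont.integrableOn_Icc).mono_set Ioo_subset_Icc_self
  constructor
  · refine Integrable.integrableOn ?_
    rw [integrable_fun_norm_addHaar (volume : Measure E2) (f := g), hprod]
    exact ((integrable_indicator_iff measurableSet_Ioo).2 hintIoo).integrableOn
  · rw [setIntegral_eq_integral_of_forall_compl_eq_zero fun x hx => indicator_of_notMem
      (fun h => hx (mem_B1.2 h.2)) _, integral_fun_norm_addHaar, hprod,
      setIntegral_indicator measurableSet_Ioo,
      inter_eq_right.2 (show Ioo s 1 ⊆ Ioi 0 from fun y hy => hs.trans hy.1),
      ← integral_Ioc_eq_integral_Ioo, ← intervalIntegral.integral_of_le hs1.le]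
    have hFTC : ∫ y in s..1, (y⁻¹ - 2 * y) =
        (Real.log 1 - 1 ^ 2) - (Real.log s - s ^ 2) := by
      refine intervalIntegral.integral_eq_sub_of_hasDerivAt (f := Real.log - fun y => y ^ 2)
        (fun y hy => ?_) (hcont.intervalIntegrable_of_Icc hs1.le)
      rw [uIcc_of_le hs1.le] at hy
      simpa using (Real.hasDerivAt_log (hs.trans_le hy.1).ne').sub (hasDerivAt_pow 2 y)
    rw [hFTC, finrank_euclideanSpace_fin, Real.log_one, nsmul_eq_mul, smul_eq_mul]
    push_cast
    ring

lemma energy_gluedFun_ge {s α : ℝ} (K : ℝ) (hs : 0 < s) (hs1 : s < 1) (hα : 0 ≤ α) :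
    2 * volume.real (Metric.ball (0 : E2) 1) * (-Real.log s - (1 - s ^ 2)) ≤
      ∫ x in B1, ‖x‖ ^ 2 * gradSq (gluedFun s K α) x := by
  obtain ⟨hint, heq⟩ := radial_lower_energy hs hs1
  rw [← heq]
  refine setIntegral_mono_on hint (integrableOn_norm_sq_mul_gradSq_gluedFun K hs hα)
    measurableSet_B1 fun x _ => ?_
  by_cases hx : ‖x‖ ∈ Ioo s 1
  · have hn : 0 < ‖x‖ := hs.trans hx.1
    rw [indicator_of_mem hx, norm_sq_mul_gradSq_gluedFun_of_gt (norm_pos_iff.1 hn) hx.1]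
    have h1 : 0 ≤ 4 * x 0 ^ 2 / ‖x‖ ^ 4 := by positivity
    calc (‖x‖ ^ 2)⁻¹ - 2 ≤ ‖x‖ ^ 2 * ((‖x‖ ^ 2)⁻¹ - 1) ^ 2 := by
          have : ‖x‖ ^ 2 * ((‖x‖ ^ 2)⁻¹ - 1) ^ 2 = (‖x‖ ^ 2)⁻¹ - 2 + ‖x‖ ^ 2 := by
            field_simp; ring
          rw [this]
          exact le_add_of_nonneg_right (sq_nonneg _)
      _ ≤ _ := by gcongr; linarith
  · rw [indicator_of_notMem hx]
    exact mul_nonneg (sq_nonneg _) (gradSq_nonneg _ _)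

lemma gluing_radius_facts {α : ℝ} (hα : 0 < α) (hα1 : α < Real.exp (-4)) :
    0 < √(α / (2 + α)) ∧ √(α / (2 + α)) < 1 ∧ α = √(α / (2 + α)) ^ 2 * (2 + α) ∧
      2 ≤ -Real.log √(α / (2 + α)) := by
  have h0 : 0 < α / (2 + α) := by positivity
  have hle : α / (2 + α) < Real.exp (-4) := (div_le_self hα.le (by linarith)).trans_lt hα1
  have hlog : Real.log (α / (2 + α)) < -4 := (Real.log_lt_iff_lt_exp h0).2 hle
  have hsq : √(α / (2 + α)) ^ 2 = α / (2 + α) := Real.sq_sqrt h0.le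
  have hlt : α / (2 + α) < 1 := by rw [div_lt_one (by positivity)]; linarith
  refine ⟨Real.sqrt_pos.2 h0, ?_, ?_, ?_⟩
  · rw [Real.sqrt_lt' one_pos]; simpa using hlt
  · rw [hsq]; field_simp
  · rw [Real.log_sqrt h0.le]; linarith

lemma tendsto_abs_log_gluing_radius :
    Tendsto (fun α : ℝ => |Real.log √(α / (2 + α))|) (nhdsWithin 0 (Ioi 0)) atTop := by
  have hc : ContinuousAt (fun α : ℝ => √(α / (2 + α))) 0 := by
    refine (ContinuousAt.div continuousAt_id (by fun_prop) (by norm_num)).sqrt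
  have h0 : Tendsto (fun α : ℝ => √(α / (2 + α))) (nhdsWithin 0 (Ioi 0))
      (nhdsWithin 0 (Ioi 0)) := by
    refine tendsto_nhdsWithin_iff.2 ⟨?_, ?_⟩
    · have := hc.tendsto
      simp only [zero_div, Real.sqrt_zero] at this
      exact this.mono_left nhdsWithin_le_nhds
    · filter_upwards [self_mem_nhdsWithin] with α hα
      have : 0 < α := hα
      exact Real.sqrt_pos.2 (by positivity)
  exact tendsto_abs_atBot_atTop.comp (Real.tendsto_log_nhdsGT_zero.comp h0)

/-- The counterexample estimates: for β ∈ (0,1) the weighted energy of ã_α with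
weight |x|²|log|x||^β is O(|log s_α|^β) while the |x|²-weighted energy of the
glued function h_α grows like |log s_α|; hence their ratio blows up as α → 0⁺. -/
theorem stmt15 :
    ∀ β : ℝ, 0 < β → β < 1 →
      ∃ C : ℝ, 0 < C ∧ ∃ α₀ : ℝ, 0 < α₀ ∧
        (∀ α : ℝ, 0 < α → α < α₀ →
          ∀ sα K : ℝ, sα = Real.sqrt (α / (2 + α)) → K = sα ^ (-α - 2) * (1 - sα ^ 2) →
            (∫ x in B1, ‖x‖ ^ 2 * |Real.log ‖x‖| ^ β * gradSq (fun y : E2 =>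
                if ‖y‖ ≤ sα then K * (α + 2) * ‖y‖ ^ α else K * (α + 2) * sα ^ α) x ≤
              C * |Real.log sα| ^ β) ∧
            C⁻¹ * |Real.log sα| ≤
              ∫ x in B1, ‖x‖ ^ 2 * gradSq (fun y : E2 =>
                if ‖y‖ ≤ sα then K * (y 0 * ‖y‖ ^ α) else y 0 / ‖y‖ ^ 2 - y 0) x) ∧
      Tendsto (fun α : ℝ =>
          (∫ x in B1, ‖x‖ ^ 2 * gradSq (fun y : E2 =>
              if ‖y‖ ≤ Real.sqrt (α / (2 + α)) then
                Real.sqrt (α / (2 + α)) ^ (-α - 2) * (1 - Real.sqrt (α / (2 + α)) ^ 2)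
                  * (y 0 * ‖y‖ ^ α)
              else y 0 / ‖y‖ ^ 2 - y 0) x) /
          (∫ x in B1, ‖x‖ ^ 2 * |Real.log ‖x‖| ^ β * gradSq (fun y : E2 =>
              if ‖y‖ ≤ Real.sqrt (α / (2 + α)) then
                Real.sqrt (α / (2 + α)) ^ (-α - 2) * (1 - Real.sqrt (α / (2 + α)) ^ 2)
                  * (α + 2) * ‖y‖ ^ α
              else Real.sqrt (α / (2 + α)) ^ (-α - 2) * (1 - Real.sqrt (α / (2 + α)) ^ 2)
                  * (α + 2) * Real.sqrt (α / (2 + α)) ^ α) x))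
        (nhdsWithin 0 (Set.Ioi 0)) atTop := by
  intro β hβ hβ1
  set v := volume.real (Metric.ball (0 : E2) 1) with hv
  have hvpos : 0 < v := ENNReal.toReal_pos (Metric.measure_ball_pos _ _ one_pos).ne'
    measure_ball_lt_top.ne
  have hI : 0 ≤ ∫ x : E2 in B1, ‖x‖⁻¹ := integral_nonneg fun x => by positivity
  set C := v⁻¹ + 81 * ∫ x : E2 in B1, ‖x‖⁻¹ with hC
  have hvC : v⁻¹ ≤ C := le_add_of_nonneg_right (by positivity)
  have hCpos : 0 < C := (inv_pos.2 hvpos).trans_le hvC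
  have hCv : C⁻¹ ≤ v := inv_le_of_inv_le₀ hvpos hvC
  have hupper : ∀ α : ℝ, 0 < α → α < Real.exp (-4) →
      (0 < ∫ x in B1, ‖x‖ ^ 2 * |Real.log ‖x‖| ^ β * gradSq (truncPow √(α / (2 + α))
        (√(α / (2 + α)) ^ (-α - 2) * (1 - √(α / (2 + α)) ^ 2) * (α + 2)) α) x) ∧
      ∫ x in B1, ‖x‖ ^ 2 * |Real.log ‖x‖| ^ β * gradSq (truncPow √(α / (2 + α))
        (√(α / (2 + α)) ^ (-α - 2) * (1 - √(α / (2 + α)) ^ 2) * (α + 2)) α) x ≤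
          C * |Real.log √(α / (2 + α))| ^ β := by
    intro α hα hα1
    obtain ⟨hs, hs1, hsα, hlog⟩ := gluing_radius_facts hα hα1
    have hα2 : α < 1 := hα1.trans (Real.exp_lt_one_iff.2 (by norm_num))
    obtain ⟨hpos, hle⟩ := weighted_energy_truncPow hs hs1 hα hα2 hsα hβ hβ1
    refine ⟨hpos, hle.trans ?_⟩
    have h1 : 1 ≤ |Real.log √(α / (2 + α))| ^ β :=
      Real.one_le_rpow (by linarith [neg_le_abs (Real.log √(α / (2 + α)))]) hβ.le
    calc 81 * ∫ x : E2 in B1, ‖x‖⁻¹ ≤ C := le_add_of_nonneg_left (by positivity)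
      _ ≤ _ := le_mul_of_one_le_right hCpos.le h1
  have hlower : ∀ α : ℝ, 0 < α → α < Real.exp (-4) →
      C⁻¹ * |Real.log √(α / (2 + α))| ≤ ∫ x in B1, ‖x‖ ^ 2 * gradSq (gluedFun √(α / (2 + α))
        (√(α / (2 + α)) ^ (-α - 2) * (1 - √(α / (2 + α)) ^ 2)) α) x := by
    intro α hα hα1
    obtain ⟨hs, hs1, hsα, hlog⟩ := gluing_radius_facts hα hα1
    refine le_trans ?_ (energy_gluedFun_ge _ hs hs1 hα.le)
    rw [abs_of_neg (Real.log_neg hs hs1), ← hv]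
    calc C⁻¹ * -Real.log √(α / (2 + α)) ≤ v * -Real.log √(α / (2 + α)) := by gcongr
      _ ≤ 2 * v * (-Real.log √(α / (2 + α)) - (1 - √(α / (2 + α)) ^ 2)) := by
        nlinarith [sq_nonneg √(α / (2 + α))]
  refine ⟨C, hCpos, Real.exp (-4), Real.exp_pos _, ?_, ?_⟩
  · rintro α hα hα1 sα K rfl rfl
    exact ⟨(hupper α hα hα1).2, hlower α hα hα1⟩
  · have hlim : Tendsto (fun α : ℝ => C⁻¹ * C⁻¹ * |Real.log √(α / (2 + α))| ^ (1 - β))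
        (nhdsWithin 0 (Ioi 0)) atTop :=
      ((tendsto_rpow_atTop (by linarith)).comp tendsto_abs_log_gluing_radius).const_mul_atTop
        (by positivity)
    refine tendsto_atTop_mono' _ ?_ hlim
    filter_upwards [Ioo_mem_nhdsGT (Real.exp_pos (-4))] with α ⟨hα, hα1⟩
    obtain ⟨hpos, hle⟩ := hupper α hα hα1
    refine le_trans ?_ (div_le_div₀
      ((by positivity : 0 ≤ C⁻¹ * |Real.log √(α / (2 + α))|).trans (hlower α hα hα1))
      (hlower α hα hα1) hpos hle)
    obtain ⟨hs, hs1, -, hlog⟩ := gluing_radius_facts hα hα1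
    have hL : 0 < |Real.log √(α / (2 + α))| := by
      linarith [neg_le_abs (Real.log √(α / (2 + α)))]
    have hLβ : 0 < |Real.log √(α / (2 + α))| ^ β := Real.rpow_pos_of_pos hL _
    rw [Real.rpow_sub hL, Real.rpow_one]
    apply le_of_eq
    field_simp
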